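/- arXiv:2508.09266 — 2 statements merged into one kernel-verified Lean document; each statement's English description precedes it below -/
import Mathlib

section
/- Let E be a real inner product space (E = ℝ³ in the paper), let n, m ∈ E be unit vectors with ⟨m, n⟩ ≠ 0, and let A : E → E be a self-adjoint, invertible continuous linear map with A n = n. Define P := id − n⊗n, Q := id − m⊗m, the oblique map G := id − (m⊗n)/⟨m, n⟩ (that is, G v = v − (⟨n, v⟩/⟨m, n⟩)·m), and set B := Q ∘ A ∘ P and B⁻ := P ∘ A⁻¹ ∘ G ∘ Q. Then B⁻ ∘ B = P and B ∘ B⁻ = Q; in particular, B maps the range of P bijectively onto the range of Q with inverse B⁻. -/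
open scoped RealInnerProductSpace
open ContinuousLinearMap

/-- The rank-one operator `(u ⊗ w) v = ⟨w, v⟩ u`. -/
noncomputable def rankOne {E : Type*} [NormedAddCommGroup E] [InnerProductSpace ℝ E]
    (u w : E) : E →L[ℝ] E :=
  (innerSL ℝ w).smulRight u

/-- The orthogonal projection `id - u ⊗ u` onto `{u}ᗮ` (for `u` a unit vector). -/
noncomputable def projPerp {E : Type*} [NormedAddCommGroup E] [InnerProductSpace ℝ E]
    (u : E) : E →L[ℝ] E :=
  ContinuousLinearMap.id ℝ E - rankOne u u

section

variable {E : Type*} [NormedAddCommGroup E] [InnerProductSpace ℝ E]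

theorem projPerp_apply (u v : E) : projPerp u v = v - ⟪u, v⟫ • u := by
  simp [projPerp, rankOne]

theorem projPerp_self {u : E} (hu : ‖u‖ = 1) : projPerp u u = 0 := by
  simp [projPerp_apply, hu]

theorem inner_projPerp {u : E} (hu : ‖u‖ = 1) (v : E) : ⟪u, projPerp u v⟫ = 0 := by
  simp [projPerp_apply, inner_sub_right, real_inner_smul_right, hu]

theorem projPerp_eq_self {u v : E} (h : ⟪u, v⟫ = 0) : projPerp u v = v := by
  simp [projPerp_apply, h]

/-- The oblique projection onto `{n}ᗮ` along `m`. -/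
noncomputable def obliqueProj (m n : E) : E →L[ℝ] E :=
  ContinuousLinearMap.id ℝ E - (⟪m, n⟫)⁻¹ • rankOne m n

theorem obliqueProj_apply (m n v : E) :
    obliqueProj m n v = v - ((⟪m, n⟫)⁻¹ * ⟪n, v⟫) • m := by
  simp [obliqueProj, rankOne, smul_smul]

theorem obliqueProj_self {m n : E} (h : ⟪m, n⟫ ≠ 0) : obliqueProj m n m = 0 := by
  simp [obliqueProj_apply, real_inner_comm m n, h]

theorem inner_obliqueProj {m n : E} (h : ⟪m, n⟫ ≠ 0) (v : E) :
    ⟪n, obliqueProj m n v⟫ = 0 := by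
  rw [obliqueProj_apply, inner_sub_right, real_inner_smul_right, real_inner_comm m n]
  field_simp
  ring

theorem obliqueProj_eq_self {m n v : E} (h : ⟪n, v⟫ = 0) : obliqueProj m n v = v := by
  simp [obliqueProj_apply, h]

theorem obliqueProj_projPerp {m n : E} (h : ⟪m, n⟫ ≠ 0) (v : E) :
    obliqueProj m n (projPerp m v) = obliqueProj m n v := by
  simp [projPerp_apply, obliqueProj_self h]

theorem projPerp_obliqueProj {m : E} (hm : ‖m‖ = 1) (n v : E) :
    projPerp m (obliqueProj m n v) = projPerp m v := by
  simp [obliqueProj_apply, projPerp_self hm]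

end

/-- with `P = id - n⊗n`, `Q = id - m⊗m`, the oblique projection
`G = id - (m⊗n)/⟨m,n⟩`, `A` self-adjoint invertible with `A n = n`,
`B = Q ∘ A ∘ P` and `B⁻ = P ∘ A⁻¹ ∘ G ∘ Q`, one has `B⁻ ∘ B = P` and `B ∘ B⁻ = Q`. -/
theorem oblique_inverse_of_tangential_gradient_map
    {E : Type*} [NormedAddCommGroup E] [InnerProductSpace ℝ E]
    (n m : E) (hn : ‖n‖ = 1) (hm : ‖m‖ = 1) (hmn : ⟪m, n⟫ ≠ 0)
    (A Ainv : E →L[ℝ] E)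
    (hA_sa : ∀ x y : E, ⟪A x, y⟫ = ⟪x, A y⟫)
    (hAinv₁ : A ∘L Ainv = ContinuousLinearMap.id ℝ E)
    (hAinv₂ : Ainv ∘L A = ContinuousLinearMap.id ℝ E)
    (hAn : A n = n)
    (P Q G B Binv : E →L[ℝ] E)
    (hP : P = projPerp n) (hQ : Q = projPerp m)
    (hG : G = ContinuousLinearMap.id ℝ E - (⟪m, n⟫)⁻¹ • rankOne m n)
    (hB : B = Q ∘L A ∘L P)
    (hBinv : Binv = P ∘L Ainv ∘L G ∘L Q) :
    Binv ∘L B = P ∧ B ∘L Binv = Q := by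
  have hA₁ (v : E) : A (Ainv v) = v := DFunLike.congr_fun hAinv₁ v
  have hA₂ (v : E) : Ainv (A v) = v := DFunLike.congr_fun hAinv₂ v
  have hA_inner (v : E) : ⟪n, A v⟫ = ⟪n, v⟫ := by rw [← hA_sa, hAn]
  have hAinv_inner (v : E) : ⟪n, Ainv v⟫ = ⟪n, v⟫ := by rw [← hA_inner, hA₁]
  change G = obliqueProj m n at hG
  subst hP hQ hG hB hBinv
  refine ⟨ContinuousLinearMap.ext fun v => ?_, ContinuousLinearMap.ext fun v => ?_⟩ <;>
    simp only [ContinuousLinearMap.comp_apply]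
  · rw [obliqueProj_projPerp hmn, obliqueProj_projPerp hmn,
      obliqueProj_eq_self ((hA_inner _).trans (inner_projPerp hn v)), hA₂,
      projPerp_eq_self (inner_projPerp hn v)]
  · have h : ⟪n, Ainv (obliqueProj m n v)⟫ = 0 :=
      (hAinv_inner _).trans (inner_obliqueProj hmn v)
    rw [obliqueProj_projPerp hmn, projPerp_eq_self h, projPerp_eq_self h, hA₁,
      projPerp_obliqueProj hm]
end

section
/- Let H be a real inner product space, N a positive integer, and Δt a real number with 0 < Δt ≤ 1/2. Let u : {0, 1, …, N} → H and let a, f : {1, …, N} → ℝ be nonnegative sequences, and suppose that for every k with 1 ≤ k ≤ N the discrete energy inequality ½(‖u_k‖² − ‖u_{k−1}‖²) + ½‖u_k − u_{k−1}‖² + Δt·a_k² ≤ Δt·f_k·‖u_k‖ holds. Then for every n with 1 ≤ n ≤ N: ‖u_n‖² + Σ_{k=1}^n ‖u_k − u_{k−1}‖² + Δt·Σ_{k=1}^n a_k² ≤ 3·exp(2·n·Δt)·(‖u_0‖² + Δt·Σ_{k=1}^n f_k²). -/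
theorem Real.one_le_one_sub_mul_exp_two_mul {x : ℝ} (hx : 0 ≤ x) (hx' : x ≤ 1 / 2) :
    1 ≤ (1 - x) * Real.exp (2 * x) := by
  nlinarith [mul_le_mul_of_nonneg_left (Real.add_one_le_exp (2 * x))
    (by linarith : 0 ≤ 1 - x)]

/-- Implicit discrete Grönwall inequality. -/
theorem le_exp_mul_of_implicit_step {N : ℕ} {τ : ℝ} (hτ : 0 ≤ τ) (hτ' : τ ≤ 1 / 2)
    {S g : ℕ → ℝ} (hS : ∀ k, 0 ≤ S k) (hg : ∀ k, 0 ≤ g k)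
    (hstep : ∀ k < N, S (k + 1) ≤ S k + τ * S (k + 1) + g (k + 1)) :
    ∀ n ≤ N, S n ≤ Real.exp (2 * n * τ) * (S 0 + ∑ k ∈ Finset.Icc 1 n, g k) := by
  intro n
  induction n with
  | zero => simp
  | succ n ih =>
    intro hn
    have hS' := ih (by omega)
    have h := hstep n (by omega)
    have hexp : Real.exp (2 * (n + 1 : ℕ) * τ) = Real.exp (2 * τ) * Real.exp (2 * n * τ) := by
      rw [← Real.exp_add]
      push_cast
      ring_nf
    rw [Finset.sum_Icc_succ_top (by omega), hexp, ← add_assoc]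
    have hone : 1 ≤ Real.exp (2 * n * τ) := Real.one_le_exp (by positivity)
    calc S (n + 1) ≤ (1 - τ) * Real.exp (2 * τ) * S (n + 1) :=
          le_mul_of_one_le_left (hS _) (Real.one_le_one_sub_mul_exp_two_mul hτ hτ')
      _ = Real.exp (2 * τ) * ((1 - τ) * S (n + 1)) := by ring
      _ ≤ Real.exp (2 * τ) * (S n + g (n + 1)) := by
          gcongr
          linarith
      _ ≤ Real.exp (2 * τ) * (Real.exp (2 * n * τ) * (S 0 + ∑ k ∈ Finset.Icc 1 n, g k)
            + Real.exp (2 * n * τ) * g (n + 1)) := by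
          gcongr
          exact le_mul_of_one_le_left (hg _) hone
      _ = _ := by ring

/-- discrete velocity stability (quantitative core of Lemma 5.1).
If the discrete energy inequality
`½(‖u_k‖² - ‖u_{k-1}‖²) + ½‖u_k - u_{k-1}‖² + Δt a_k² ≤ Δt f_k ‖u_k‖`
holds for `1 ≤ k ≤ N`, with `0 < Δt ≤ 1/2` and `a, f` nonnegative, then for all
`1 ≤ n ≤ N`:
`‖u_n‖² + Σ_{k=1}^n ‖u_k - u_{k-1}‖² + Δt Σ_{k=1}^n a_k²
  ≤ 3 exp(2 n Δt) (‖u_0‖² + Δt Σ_{k=1}^n f_k²)`. -/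
theorem discrete_velocity_stability
    {H : Type*} [NormedAddCommGroup H] [InnerProductSpace ℝ H]
    (N : ℕ) (hN : 0 < N) (Δt : ℝ) (hΔt : 0 < Δt) (hΔt' : Δt ≤ 1 / 2)
    (u : ℕ → H) (a f : ℕ → ℝ)
    (ha : ∀ k, 1 ≤ k → k ≤ N → 0 ≤ a k)
    (hf : ∀ k, 1 ≤ k → k ≤ N → 0 ≤ f k)
    (hstep : ∀ k, 1 ≤ k → k ≤ N →
      (1 / 2) * (‖u k‖ ^ 2 - ‖u (k - 1)‖ ^ 2) + (1 / 2) * ‖u k - u (k - 1)‖ ^ 2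
          + Δt * a k ^ 2
        ≤ Δt * f k * ‖u k‖) :
    ∀ n, 1 ≤ n → n ≤ N →
      ‖u n‖ ^ 2 + (∑ k ∈ Finset.Icc 1 n, ‖u k - u (k - 1)‖ ^ 2)
          + Δt * ∑ k ∈ Finset.Icc 1 n, a k ^ 2
        ≤ 3 * Real.exp (2 * n * Δt) *
            (‖u 0‖ ^ 2 + Δt * ∑ k ∈ Finset.Icc 1 n, f k ^ 2) := by
  intro n _ hnN
  have hgron := le_exp_mul_of_implicit_step (N := N) (g := fun k => Δt * f k ^ 2)
    (S := fun n => ‖u n‖ ^ 2 + (∑ k ∈ Finset.Icc 1 n, ‖u k - u (k - 1)‖ ^ 2)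
      + Δt * ∑ k ∈ Finset.Icc 1 n, a k ^ 2)
    hΔt.le hΔt' (fun _ => by positivity) (fun _ => by positivity) ?_ n hnN
  · simp only [← Finset.mul_sum, Finset.Icc_eq_empty_of_lt zero_lt_one, Finset.sum_empty,
      mul_zero, add_zero] at hgron
    refine hgron.trans ?_
    gcongr
    exact le_mul_of_one_le_left (Real.exp_nonneg _) (by norm_num)
  · intro k hk
    have h := hstep (k + 1) (by omega) (by omega)
    simp only [Finset.sum_Icc_succ_top (Nat.le_add_left 1 k), Nat.add_sub_cancel] at h ⊢
    have hyoung := mul_nonneg hΔt.le (sq_nonneg (f (k + 1) - ‖u (k + 1)‖))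
    have hkick : Δt * ‖u (k + 1)‖ ^ 2 ≤ Δt * (‖u (k + 1)‖ ^ 2
        + (∑ j ∈ Finset.Icc 1 k, ‖u j - u (j - 1)‖ ^ 2 + ‖u (k + 1) - u k‖ ^ 2)
        + Δt * (∑ j ∈ Finset.Icc 1 k, a j ^ 2 + a (k + 1) ^ 2)) := by
      gcongr
      rw [add_assoc]
      exact le_add_of_nonneg_right (by positivity)
    have ha_sq := mul_nonneg hΔt.le (sq_nonneg (a (k + 1)))
    linarith
end
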